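/- arXiv:2007.09017 — 4 statements merged into one kernel-verified Lean document; each statement's English description precedes it below -/
import Mathlib

section
/- Let G be an unweighted resource graph game on m resources whose cost function c : ℤ_{≥0}^m → ℝ^m is given by c(x) = (f_1(x_1),…,f_m(x_m))ᵀ + A x, where f_1,…,f_m : ℤ_{≥0} → ℝ are arbitrary functions and A ∈ ℝ^{m×m} is a symmetric matrix. Then G has a pure Nash equilibrium. -/
open Finset

/-- The indicator vector of a set `S` of resources. -/
def indicVec {m : ℕ} (S : Finset (Fin m)) : Fin m → ℕ :=
  fun r => if r ∈ S then 1 else 0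

/-- The load vector induced by a strategy profile `x`. -/
def loadVec {n m : ℕ} (x : Fin n → Fin m → ℕ) : Fin m → ℕ :=
  fun r => ∑ i, x i r

/-- The private cost of player `i` in profile `x` with cost function `c`. -/
def playerCost {n m : ℕ} (c : (Fin m → ℕ) → Fin m → ℝ)
    (x : Fin n → Fin m → ℕ) (i : Fin n) : ℝ :=
  ∑ r, (x i r : ℝ) * c (loadVec x) r

/-- `X` is a valid system of strategy sets for an unweighted resource graph game:
each `X i` is a nonempty finite set of `0/1`-vectors. -/
def IsStrategySets {n m : ℕ} (X : Fin n → Finset (Fin m → ℕ)) : Prop :=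
  (∀ i, (X i).Nonempty) ∧ ∀ i, ∀ v ∈ X i, ∀ r, v r ≤ 1

/-- `x` is a pure Nash equilibrium of the unweighted resource graph game with
strategy sets `X` and cost function `c`. -/
def IsPNE {n m : ℕ} (c : (Fin m → ℕ) → Fin m → ℝ)
    (X : Fin n → Finset (Fin m → ℕ)) (x : Fin n → Fin m → ℕ) : Prop :=
  (∀ i, x i ∈ X i) ∧
    ∀ i, ∀ y ∈ X i, playerCost c x i ≤ playerCost c (Function.update x i y) i

/-- The composition `c ⊕ c'` of two cost functions. -/
def oplus {m m' : ℕ} (c : (Fin m → ℕ) → Fin m → ℝ)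
    (c' : (Fin m' → ℕ) → Fin m' → ℝ) :
    (Fin (m + m') → ℕ) → Fin (m + m') → ℝ :=
  fun x => Fin.addCases (motive := fun _ => ℝ)
    (fun i => c (fun j => x (Fin.castAdd m' j)) i)
    (fun i => c' (fun j => x (Fin.natAdd m j)) i)

/-- A set of cost functions, one set for each number `m` of resources. -/
abbrev CostFamily := (m : ℕ) → Set ((Fin m → ℕ) → Fin m → ℝ)

/-- `𝒞` is closed under composition. -/
def ClosedUnderComposition (𝒞 : CostFamily) : Prop :=
  ∀ m m' : ℕ, ∀ c ∈ 𝒞 m, ∀ c' ∈ 𝒞 m', oplus c c' ∈ 𝒞 (m + m')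

/-- `𝒞` is consistent for unweighted resource graph games: every unweighted
resource graph game whose cost function belongs to `𝒞` has a pure Nash equilibrium. -/
def Consistent (𝒞 : CostFamily) : Prop :=
  ∀ m : ℕ, ∀ c ∈ 𝒞 m, ∀ n : ℕ, ∀ X : Fin n → Finset (Fin m → ℕ),
    IsStrategySets X → ∃ x, IsPNE c X x

/-- The quadratic form `zᵀ A z` on integer vectors. -/
def quadForm {m : ℕ} (A : Matrix (Fin m) (Fin m) ℝ) (z : Fin m → ℕ) : ℝ :=
  ∑ r, (z r : ℝ) * ∑ s, A r s * (z s : ℝ)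

/-- The load-dependent part of the potential: Rosenthal's sum plus half the quadratic form. -/
noncomputable def loadPotential {m : ℕ} (f : Fin m → ℕ → ℝ) (A : Matrix (Fin m) (Fin m) ℝ)
    (z : Fin m → ℕ) : ℝ :=
  ∑ r, ∑ k ∈ range (z r), f r (k + 1) + quadForm A z / 2

/-- An exact potential for games with a separable plus symmetric linear cost function. -/
noncomputable def potential {n m : ℕ} (f : Fin m → ℕ → ℝ) (A : Matrix (Fin m) (Fin m) ℝ)
    (x : Fin n → Fin m → ℕ) : ℝ :=
  loadPotential f A (loadVec x) + (∑ i, quadForm A (x i)) / 2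

theorem quadForm_add {m : ℕ} {A : Matrix (Fin m) (Fin m) ℝ} (hA : A.IsSymm)
    (v w : Fin m → ℕ) :
    quadForm A (v + w) =
      quadForm A v + quadForm A w + 2 * ∑ r, (v r : ℝ) * ∑ s, A r s * (w s : ℝ) := by
  have h : ∑ r, (w r : ℝ) * ∑ s, A r s * (v s : ℝ) =
      ∑ r, (v r : ℝ) * ∑ s, A r s * (w s : ℝ) := by
    simp only [mul_sum]
    rw [sum_comm]
    refine sum_congr rfl fun r _ => sum_congr rfl fun s _ => ?_
    rw [hA.apply r s]
    ring
  have h' : quadForm A (v + w) = quadForm A v + quadForm A w +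
      ∑ r, (v r : ℝ) * ∑ s, A r s * (w s : ℝ) + ∑ r, (w r : ℝ) * ∑ s, A r s * (v s : ℝ) := by
    simp only [quadForm, ← sum_add_distrib]
    refine sum_congr rfl fun r _ => ?_
    simp only [Pi.add_apply, Nat.cast_add, mul_add, sum_add_distrib]
    ring
  rw [h', h]
  ring

/-- The cost of playing `v` against the load `w` of the other players is the increase of
the load potential plus half the quadratic form of `v`. -/
theorem loadPotential_add {m : ℕ} (f : Fin m → ℕ → ℝ) {A : Matrix (Fin m) (Fin m) ℝ}
    (hA : A.IsSymm) {v : Fin m → ℕ} (hv : ∀ r, v r ≤ 1) (w : Fin m → ℕ) :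
    loadPotential f A (v + w) + quadForm A v / 2 = loadPotential f A w +
      ∑ r, (v r : ℝ) * (f r ((v + w) r) + ∑ s, A r s * ((v + w) s : ℝ)) := by
  have hf : ∑ r, ∑ k ∈ range ((v + w) r), f r (k + 1) =
      ∑ r, ∑ k ∈ range (w r), f r (k + 1) + ∑ r, (v r : ℝ) * f r ((v + w) r) := by
    rw [← sum_add_distrib]
    refine sum_congr rfl fun r _ => ?_
    have := hv r
    interval_cases h : v r <;> simp [h, add_comm 1, sum_range_succ]
  have hq : ∑ r, (v r : ℝ) * (f r ((v + w) r) + ∑ s, A r s * ((v + w) s : ℝ)) =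
      ∑ r, (v r : ℝ) * f r ((v + w) r) + quadForm A v +
        ∑ r, (v r : ℝ) * ∑ s, A r s * (w s : ℝ) := by
    simp only [quadForm, ← sum_add_distrib]
    refine sum_congr rfl fun r _ => ?_
    simp only [Pi.add_apply, Nat.cast_add, mul_add, sum_add_distrib]
    ring
  rw [loadPotential, loadPotential, hf, hq, quadForm_add hA]
  ring

theorem loadVec_update {n m : ℕ} (x : Fin n → Fin m → ℕ) (i : Fin n) (y : Fin m → ℕ) :
    loadVec (Function.update x i y) = y + ∑ j ∈ univ.erase i, x j := by
  ext r
  rw [loadVec, ← add_sum_erase _ _ (mem_univ i), Pi.add_apply, Finset.sum_apply,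
    Function.update_self]
  congr 1
  exact sum_congr rfl fun j hj => by rw [Function.update_of_ne (ne_of_mem_erase hj)]

/-- The potential and the cost of player `i` differ by a quantity that does not depend on
the strategy of player `i`. -/
theorem potential_update {n m : ℕ} {f : Fin m → ℕ → ℝ} {A : Matrix (Fin m) (Fin m) ℝ}
    (hA : A.IsSymm) {c : (Fin m → ℕ) → Fin m → ℝ}
    (hc : ∀ x r, c x r = f r (x r) + ∑ s, A r s * (x s : ℝ))
    (x : Fin n → Fin m → ℕ) (i : Fin n) {y : Fin m → ℕ} (hy : ∀ r, y r ≤ 1) :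
    potential f A (Function.update x i y) =
      playerCost c (Function.update x i y) i +
        (loadPotential f A (∑ j ∈ univ.erase i, x j) +
          (∑ j ∈ univ.erase i, quadForm A (x j)) / 2) := by
  have hs : ∑ j, quadForm A (Function.update x i y j) =
      quadForm A y + ∑ j ∈ univ.erase i, quadForm A (x j) := by
    rw [← add_sum_erase _ _ (mem_univ i), Function.update_self]
    congr 1
    exact sum_congr rfl fun j hj => by rw [Function.update_of_ne (ne_of_mem_erase hj)]
  have h := loadPotential_add f hA hy (∑ j ∈ univ.erase i, x j)
  simp only [potential, playerCost, hc, hs, loadVec_update, Function.update_self]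
  linarith

/-- Lemma 1: every unweighted resource graph game whose cost function is the sum of
an arbitrary separable part and a symmetric linear part has a pure Nash equilibrium. -/
theorem exists_pne_unweighted_structured (m n : ℕ) (f : Fin m → ℕ → ℝ)
    (A : Matrix (Fin m) (Fin m) ℝ) (hA : A.IsSymm)
    (c : (Fin m → ℕ) → Fin m → ℝ)
    (hc : ∀ x r, c x r = f r (x r) + ∑ s, A r s * (x s : ℝ))
    (X : Fin n → Finset (Fin m → ℕ)) (hX : IsStrategySets X) :
    ∃ x, IsPNE c X x := by
  obtain ⟨x, hx, hmin⟩ := (Fintype.piFinset X).exists_min_image (potential f A)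
    (Fintype.piFinset_nonempty.2 hX.1)
  rw [Fintype.mem_piFinset] at hx
  refine ⟨x, hx, fun i y hy => ?_⟩
  have hxy := hmin (Function.update x i y) <| Fintype.mem_piFinset.2 fun j => by
    rcases eq_or_ne j i with rfl | hj
    · rwa [Function.update_self]
    · rw [Function.update_of_ne hj]
      exact hx j
  have h₁ := potential_update hA hc x i (hX.2 i (x i) (hx i))
  have h₂ := potential_update hA hc x i (hX.2 i y hy)
  rw [Function.update_eq_self] at h₁
  linarith
end

section
/- Let G be an unweighted resource graph game on m resources whose cost function is c(x) = (f_1(x_1),…,f_m(x_m))ᵀ + A x with A ∈ ℝ^{m×m} symmetric. Define P(x) = Σ_{r∈R} Σ_{k=1}^{x̄_r} f_r(k) + (1/2) x̄ᵀ A x̄ + (1/2) Σ_{i∈N} x_iᵀ A x_i, where x̄ = Σ_{i∈N} x_i. Then P is an exact potential function for G: for every player i, every strategy profile x, and every y_i ∈ X_i, P(y_i, x_{−i}) − P(x) = π_i(y_i, x_{−i}) − π_i(x). -/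
open Finset

theorem sum_comp_eq_sum_update_zero_add {ι α M : Type*} [Fintype ι] [DecidableEq ι] [Zero α]
    [AddCommMonoid M] (F : α → M) (hF : F 0 = 0) (x : ι → α) (i : ι) :
    ∑ j, F (x j) = ∑ j, F (Function.update x i 0 j) + F (x i) := by
  have h : ∑ j ∈ Finset.univ.erase i, F (x j)
      = ∑ j ∈ Finset.univ.erase i, F (Function.update x i 0 j) :=
    Finset.sum_congr rfl fun j hj => by rw [Function.update_of_ne (Finset.ne_of_mem_erase hj)]
  rw [← Finset.sum_erase_add _ _ (Finset.mem_univ i), h,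
    ← Finset.sum_erase_add _ (fun j => F (Function.update x i 0 j)) (Finset.mem_univ i)]
  simp [hF]

theorem loadVec_eq_update_zero_add {n m : ℕ} (x : Fin n → Fin m → ℕ) (i : Fin n) (r : Fin m) :
    loadVec x r = loadVec (Function.update x i 0) r + x i r :=
  sum_comp_eq_sum_update_zero_add (fun v : Fin m → ℕ => v r) rfl x i

theorem sum_Icc_one_add_of_le_one (g : ℕ → ℝ) (z a : ℕ) (ha : a ≤ 1) :
    ∑ k ∈ Finset.Icc 1 (z + a), g k = ∑ k ∈ Finset.Icc 1 z, g k + a * g (z + a) := by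
  interval_cases a
  · simp
  · simp [Finset.sum_Icc_succ_top]

theorem sum_quadratic_update_zero {n m : ℕ} (A : Matrix (Fin m) (Fin m) ℝ)
    (x : Fin n → Fin m → ℕ) (i : Fin n) :
    ∑ j, ∑ r, ∑ s, (x j r : ℝ) * A r s * (x j s : ℝ)
      = (∑ j, ∑ r, ∑ s, (Function.update x i 0 j r : ℝ) * A r s * (Function.update x i 0 j s : ℝ))
        + ∑ r, ∑ s, (x i r : ℝ) * A r s * (x i s : ℝ) :=
  sum_comp_eq_sum_update_zero_add
    (fun v : Fin m → ℕ => ∑ r, ∑ s, (v r : ℝ) * A r s * (v s : ℝ)) (by simp) x i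

theorem half_quadratic_add {m : ℕ} (A : Matrix (Fin m) (Fin m) ℝ) (hA : A.IsSymm)
    (z a : Fin m → ℝ) :
    (1 / 2) * ∑ r, ∑ s, (z r + a r) * A r s * (z s + a s)
        + (1 / 2) * ∑ r, ∑ s, a r * A r s * a s
      = (1 / 2) * ∑ r, ∑ s, z r * A r s * z s + ∑ r, a r * ∑ s, A r s * (z s + a s) := by
  have hsymm : ∑ r, ∑ s, z r * A r s * a s = ∑ r, ∑ s, a r * A r s * z s := by
    rw [Finset.sum_comm]
    refine Finset.sum_congr rfl fun r _ => Finset.sum_congr rfl fun s _ => ?_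
    rw [hA.apply r s]
    ring
  simp only [mul_add, add_mul, Finset.sum_add_distrib, Finset.mul_sum, ← mul_assoc] at hsymm ⊢
  simp only [mul_assoc, ← Finset.mul_sum] at hsymm ⊢
  linarith

/-- The function `P` is an exact potential for unweighted resource graph games
with cost functions that are the sum of a separable part and a symmetric linear part. -/
theorem exact_potential_unweighted (m n : ℕ) (f : Fin m → ℕ → ℝ)
    (A : Matrix (Fin m) (Fin m) ℝ) (hA : A.IsSymm)
    (c : (Fin m → ℕ) → Fin m → ℝ)
    (hc : ∀ x r, c x r = f r (x r) + ∑ s, A r s * (x s : ℝ))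
    (X : Fin n → Finset (Fin m → ℕ)) (hX : IsStrategySets X)
    (P : (Fin n → Fin m → ℕ) → ℝ)
    (hP : ∀ x : Fin n → Fin m → ℕ,
      P x = (∑ r, ∑ k ∈ Finset.Icc 1 (loadVec x r), f r k)
        + (1 / 2) * ∑ r, ∑ s, (loadVec x r : ℝ) * A r s * (loadVec x s : ℝ)
        + (1 / 2) * ∑ i, ∑ r, ∑ s, (x i r : ℝ) * A r s * (x i s : ℝ)) :
    ∀ x : Fin n → Fin m → ℕ, (∀ j, x j ∈ X j) →
      ∀ i : Fin n, ∀ y ∈ X i,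
        P (Function.update x i y) - P x
          = playerCost c (Function.update x i y) i - playerCost c x i := by
  have key : ∀ x : Fin n → Fin m → ℕ, ∀ i, (∀ r, x i r ≤ 1) →
      P x = P (Function.update x i 0) + playerCost c x i := by
    intro x i hx
    have hquad := half_quadratic_add A hA
      (fun r => (loadVec (Function.update x i 0) r : ℝ)) (fun r => (x i r : ℝ))
    rw [hP, hP, sum_quadratic_update_zero A x i]
    simp only [playerCost, hc, loadVec_eq_update_zero_add x i, Nat.cast_add,
      sum_Icc_one_add_of_le_one _ _ _ (hx _), Finset.sum_add_distrib, mul_add (x i _ : ℝ)]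
    linarith
  intro x hx i y hy
  have h₁ := key x i (hX.2 i _ (hx i))
  have h₂ := key (Function.update x i y) i (by simpa using hX.2 i y hy)
  rw [Function.update_idem] at h₂
  linarith
end

section
/- If a finite strategic game G = (N, X, (π_i)_{i∈N}) is (A, B)-symmetric for two players i, j ∈ N and admits a pure Nash equilibrium, then A = B. -/
/-- If a finite strategic game is `(A, B)`-symmetric for two players `i, j` and
admits a pure Nash equilibrium, then `A = B`. -/
theorem symmetric_game_pne_eq {ι : Type*} [Fintype ι] [DecidableEq ι]
    (S : ι → Type*) [∀ i, Fintype (S i)] [∀ i, Nonempty (S i)]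
    (π : ι → ((j : ι) → S j) → ℝ) (A B : ℝ) (i j : ι) (hij : i ≠ j)
    (hsym1 : ∀ x : (k : ι) → S k,
      (π i x = A ∧ π j x = B) ∨ (π i x = B ∧ π j x = A))
    (hsym2 : ∀ x : (k : ι) → S k, ∃ yi : S i, ∃ yj : S j,
      π i (Function.update x i yi) = π j x ∧ π j (Function.update x j yj) = π i x)
    (hpne : ∃ x : (k : ι) → S k, ∀ k : ι, ∀ y : S k,
      π k x ≤ π k (Function.update x k y)) :
    A = B := by
  obtain ⟨x, hx⟩ := hpne
  obtain ⟨yi, yj, hyi, hyj⟩ := hsym2 x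
  have hle : π i x ≤ π j x := hyi ▸ hx i yi
  have hge : π j x ≤ π i x := hyj ▸ hx j yj
  rcases hsym1 x with ⟨hA, hB⟩ | ⟨hB, hA⟩ <;> linarith
end

section
/- Let 𝒞 be a set of cost functions that is closed under composition and consistent for unweighted resource graph games. Then for every c ∈ 𝒞 with c : ℤ_{≥0}^m → ℝ^m for some m ∈ ℕ, for all resources r, s ∈ {1,…,m} and all x ∈ ℤ_{≥0}^m it holds that c_r(x + 1_{{r,s}}) − c_r(x + 1_r) = c_s(x + 1_{{r,s}}) − c_s(x + 1_s). -/
open Finset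

/-- The cost of strategy `p` when the other players induce the load `z + q`. -/
def duelCost {m : ℕ} (c : (Fin m → ℕ) → Fin m → ℝ) (z p q : Fin m → ℕ) : ℝ :=
  ∑ t, (p t : ℝ) * c (z + p + q) t

lemma sum_threshold {N a : ℕ} (h : a ≤ N) :
    ∑ j : Fin N, (if (j : ℕ) < a then 1 else 0) = a := by
  rw [Fin.sum_univ_eq_sum_range (fun j => if j < a then 1 else 0) N, ← card_filter]
  have : (range N).filter (· < a) = range a := by
    ext j
    simp only [mem_filter, mem_range]
    omega
  rw [this, card_range]

/-- A consistent family admits equilibria of two-player games with an arbitrary fixed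
background load `z`. -/
lemma Consistent.exists_duel_equilibrium {𝒞 : CostFamily} (hcons : Consistent 𝒞) {m : ℕ}
    {c : (Fin m → ℕ) → Fin m → ℝ} (hc : c ∈ 𝒞 m) (z : Fin m → ℕ)
    (A B : Finset (Fin m → ℕ)) (hA : A.Nonempty) (hB : B.Nonempty)
    (hA1 : ∀ v ∈ A, ∀ t, v t ≤ 1) (hB1 : ∀ v ∈ B, ∀ t, v t ≤ 1) :
    ∃ p ∈ A, ∃ q ∈ B, (∀ p' ∈ A, duelCost c z p q ≤ duelCost c z p' q) ∧
      ∀ q' ∈ B, duelCost c z q p ≤ duelCost c z q' p := by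
  let bg : Fin (∑ t, z t) → Fin m → ℕ := fun j t => if (j : ℕ) < z t then 1 else 0
  let X : Fin ((∑ t, z t) + 1 + 1) → Finset (Fin m → ℕ) :=
    Fin.cons A (Fin.cons B fun j => {bg j})
  have hX : IsStrategySets X := by
    refine ⟨?_, ?_⟩
    · refine Fin.cases hA (Fin.cases hB fun j => ?_)
      exact singleton_nonempty (bg j)
    · refine Fin.cases hA1 (Fin.cases hB1 fun j => ?_)
      intro v hv t
      obtain rfl : v = bg j := mem_singleton.1 hv
      change (if _ then 1 else 0) ≤ 1
      split_ifs <;> simp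
  have hload : ∀ y : Fin ((∑ t, z t) + 1 + 1) → Fin m → ℕ, (∀ i, y i ∈ X i) →
      loadVec y = z + y 0 + y 1 := by
    intro y hy
    have hbg : ∀ j : Fin (∑ t, z t), y j.succ.succ = bg j := fun j =>
      mem_singleton.1 (hy j.succ.succ)
    ext t
    simp only [loadVec, Fin.sum_univ_succ, hbg, Pi.add_apply, bg]
    rw [sum_threshold (single_le_sum (fun _ _ => Nat.zero_le _) (mem_univ t))]
    simp only [Fin.succ_zero_eq_one]
    omega
  obtain ⟨y, hy, hmin⟩ := hcons m c hc _ X hX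
  have hupd : ∀ i, ∀ v ∈ X i, ∀ k, Function.update y i v k ∈ X k := by
    intro i v hv k
    rcases eq_or_ne k i with rfl | hk
    · simpa using hv
    · simpa [hk] using hy k
  refine ⟨y 0, hy 0, y 1, hy 1, fun p' hp' => ?_, fun q' hq' => ?_⟩
  · have h := hmin 0 p' hp'
    simpa [playerCost, hload y hy, hload _ (hupd 0 p' hp'), duelCost] using h
  · have h := hmin 1 q' hq'
    simpa [playerCost, hload y hy, hload _ (hupd 1 q' hq'), duelCost, add_right_comm] using h

lemma duelCost_oplus {m m' : ℕ} (c : (Fin m → ℕ) → Fin m → ℝ)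
    (c' : (Fin m' → ℕ) → Fin m' → ℝ) (z p q : Fin m → ℕ) (z' p' q' : Fin m' → ℕ) :
    duelCost (oplus c c') (Fin.append z z') (Fin.append p p') (Fin.append q q')
      = duelCost c z p q + duelCost c' z' p' q' := by
  simp only [duelCost, oplus, Fin.sum_univ_add, Fin.append_left, Fin.append_right,
    Fin.addCases_left, Fin.addCases_right, Pi.add_apply]
  rfl

lemma duelCost_zero {m : ℕ} (c : (Fin m → ℕ) → Fin m → ℝ) (z q : Fin m → ℕ) :
    duelCost c z 0 q = 0 := by
  simp [duelCost]

lemma duelCost_indicVec_singleton {m : ℕ} (c : (Fin m → ℕ) → Fin m → ℝ) (z q : Fin m → ℕ)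
    (r : Fin m) : duelCost c z (indicVec {r}) q = c (z + indicVec {r} + q) r := by
  simp [duelCost, indicVec]

lemma indicVec_le_one {m : ℕ} (S : Finset (Fin m)) (t : Fin m) : indicVec S t ≤ 1 := by
  unfold indicVec
  split_ifs <;> simp

lemma indicVec_pair {m : ℕ} {r s : Fin m} (h : r ≠ s) :
    indicVec {r, s} = indicVec {r} + indicVec {s} := by
  ext t
  simp only [indicVec, mem_insert, mem_singleton, Pi.add_apply]
  grind

lemma append_le_one {m m' : ℕ} {u : Fin m → ℕ} {v : Fin m' → ℕ} (hu : ∀ t, u t ≤ 1)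
    (hv : ∀ t, v t ≤ 1) (t : Fin (m + m')) : Fin.append u v t ≤ 1 := by
  refine Fin.addCases (fun i => ?_) (fun i => ?_) t
  · simpa using hu i
  · simpa using hv i

/-- Lemma (symmetric discrete Jacobian): for consistent, composition-closed sets of
cost functions, the mutual influences of resources are symmetric. -/
theorem symmetric_jacobi_unweighted (𝒞 : CostFamily)
    (hcomp : ClosedUnderComposition 𝒞) (hcons : Consistent 𝒞)
    (m : ℕ) (c : (Fin m → ℕ) → Fin m → ℝ) (hc : c ∈ 𝒞 m)
    (r s : Fin m) (x : Fin m → ℕ) :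
    c (x + indicVec {r, s}) r - c (x + indicVec {r}) r
      = c (x + indicVec {r, s}) s - c (x + indicVec {s}) s := by
  rcases eq_or_ne r s with rfl | hrs
  · rfl
  have hc2 := hcomp m m c hc c hc
  have hc4 := hcomp _ _ _ hc2 _ hc2
  -- In four copies of the game, two players chase each other around a cycle of profiles in
  -- which every move changes the mover's cost by the same difference of mutual influences.
  let e := indicVec {r}
  let f := indicVec {s}
  let quad := fun a b d g : Fin m → ℕ => Fin.append (Fin.append a b) (Fin.append d g)
  have hr : ∀ t, e t ≤ 1 := indicVec_le_one {r}
  have hs : ∀ t, f t ≤ 1 := indicVec_le_one {s}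
  have h0 : ∀ t, (0 : Fin m → ℕ) t ≤ 1 := fun _ => Nat.zero_le _
  have hquad : ∀ {a b d g : Fin m → ℕ}, (∀ t, a t ≤ 1) → (∀ t, b t ≤ 1) → (∀ t, d t ≤ 1) →
      (∀ t, g t ≤ 1) → ∀ t, quad a b d g t ≤ 1 := fun ha hb hd hg =>
    append_le_one (append_le_one ha hb) (append_le_one hd hg)
  obtain ⟨p, hp, q, hq, hpmin, hqmin⟩ := hcons.exists_duel_equilibrium hc4 (quad x x x x)
    {quad e 0 0 f, quad 0 f e 0} {quad f e 0 0, quad 0 0 f e}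
    (insert_nonempty _ _) (insert_nonempty _ _)
    (by
      simp only [mem_insert, mem_singleton]
      rintro v (rfl | rfl)
      exacts [hquad hr h0 h0 hs, hquad h0 hs hr h0])
    (by
      simp only [mem_insert, mem_singleton]
      rintro v (rfl | rfl)
      exacts [hquad hs hr h0 h0, hquad h0 h0 hs hr])
  have hcomm : x + indicVec {s} + indicVec {r} = x + indicVec {r} + indicVec {s} :=
    add_right_comm _ _ _
  rw [indicVec_pair hrs, ← add_assoc]
  simp only [mem_insert, mem_singleton, forall_eq_or_imp, forall_eq] at hp hq hpmin hqmin
  rcases hp with rfl | rfl <;> rcases hq with rfl | rfl <;>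
    simp only [quad, e, f, duelCost_oplus, duelCost_zero, duelCost_indicVec_singleton, add_zero,
      hcomm] at hpmin hqmin <;>
    obtain ⟨h1, h2⟩ := hpmin <;> obtain ⟨h3, h4⟩ := hqmin <;> linarith
end
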